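/- Let λ̄ > 0 and ū ∈ H satisfy the eigenvalue relation a(ū, v) = λ̄ b(ū, v) for all v ∈ H. Let S ⊆ H be a subspace and q ∈ H be such that λ̄ · T q ∈ S. Then ‖ū − P_S ū‖_a ≤ λ̄ η_a(S) ‖ū − q‖_b. (Combination of the identity-based estimate with the duality estimate, expressing that the a-norm error of the projection onto the augmented subspace is controlled by λ̄ η_a(S) times the b-norm error of the previous approximation.) -/

import Mathlib

open RealInnerProductSpace

/-- Uniqueness for the variational problem posed on a subspace on which `a` is definite. -/
theorem eq_of_bilin_eq_on {W : Type*} [AddCommGroup W] [Module ℝ W] {H : Submodule ℝ W}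
    {a : LinearMap.BilinForm ℝ W} (hpos : ∀ v ∈ H, v ≠ 0 → 0 < a v v) {x y : W}
    (hx : x ∈ H) (hy : y ∈ H) (h : ∀ v ∈ H, a x v = a y v) : x = y := by
  by_contra hne
  have hmem := H.sub_mem hx hy
  have := hpos _ hmem (sub_ne_zero.2 hne)
  rw [LinearMap.map_sub₂, h _ hmem, sub_self] at this
  exact this.false

/-- On a finite-dimensional subspace on which `a` is definite, the solution operator is bounded. -/
theorem exists_norm_solution_le {W : Type*} [NormedAddCommGroup W] [InnerProductSpace ℝ W]
    {H : Submodule ℝ W} [FiniteDimensional ℝ H] {a : LinearMap.BilinForm ℝ W}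
    (hpos : ∀ v ∈ H, v ≠ 0 → 0 < a v v) {T : W → W} (hTmem : ∀ f, T f ∈ H)
    (hT : ∀ f, ∀ v ∈ H, a (T f) v = ⟪f, v⟫) :
    ∃ K : ℝ, 0 ≤ K ∧ ∀ f, ‖T f‖ ≤ K * ‖f‖ := by
  let A : H →ₗ[ℝ] (H →L[ℝ] ℝ) :=
    (LinearMap.toContinuousLinearMap (𝕜 := ℝ) (E := H) (F' := ℝ)).toLinearMap ∘ₗ
      a.domRestrict₁₂ H H
  have hA : ∀ x y : H, A x y = a x y := fun _ _ => rfl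
  have hker : LinearMap.ker A = ⊥ := by
    refine LinearMap.ker_eq_bot'.2 fun x hx => Subtype.ext ?_
    refine eq_of_bilin_eq_on hpos x.2 H.zero_mem fun v hv => ?_
    simpa [hx] using (hA x ⟨v, hv⟩).symm
  obtain ⟨K, -, hK⟩ := LinearMap.exists_antilipschitzWith (𝕜 := ℝ) (E := H) (F := H →L[ℝ] ℝ) A hker
  refine ⟨K, K.2, fun f => ?_⟩
  have hle : ‖(⟨T f, hTmem f⟩ : H)‖ ≤ K * ‖A ⟨T f, hTmem f⟩‖ :=
    ZeroHomClass.bound_of_antilipschitz A hK _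
  refine hle.trans (mul_le_mul_of_nonneg_left ?_ K.2)
  refine ContinuousLinearMap.opNorm_le_bound _ (norm_nonneg f) fun v => ?_
  rw [hA, hT f v v.2]
  exact norm_inner_le_norm f (v : W)

/-- The best approximation property of the orthogonal projection. -/
theorem bilin_le_of_orthogonal {W : Type*} [AddCommGroup W] [Module ℝ W] {S : Submodule ℝ W}
    {a : LinearMap.BilinForm ℝ W} (hsymm : ∀ x y, a x y = a y x)
    (hnonneg : ∀ v ∈ S, 0 ≤ a v v) {u p s : W} (hp : p ∈ S) (hs : s ∈ S)
    (horth : ∀ v ∈ S, a (u - p) v = 0) : a (u - p) (u - p) ≤ a (u - s) (u - s) := by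
  have hd := S.sub_mem hp hs
  have heq : u - s = (u - p) + (p - s) := by abel
  have h := horth _ hd
  have h' := hsymm (u - p) (p - s)
  rw [heq]
  simp only [map_add (a : W →ₗ[ℝ] W →ₗ[ℝ] ℝ) (u - p), LinearMap.add_apply,
    map_add (a (u - p)), map_add (a (p - s))]
  linarith [hnonneg _ hd]

/-- Combining the identity-based estimate with the duality
estimate: if `a(ū, v) = λ̄ b(ū, v)` for all `v ∈ H` and `λ̄ T q ∈ S`, then
`‖ū − P_S ū‖_a ≤ λ̄ η_a(S) ‖ū − q‖_b`. -/
theorem augmented_subspace_energy_estimate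
    {W : Type*} [NormedAddCommGroup W] [InnerProductSpace ℝ W]
    (H S : Submodule ℝ W) (hSH : S ≤ H) [FiniteDimensional ℝ H]
    (a : LinearMap.BilinForm ℝ W)
    (hsymm : ∀ x y : W, a x y = a y x)
    (hpos : ∀ v ∈ H, v ≠ 0 → 0 < a v v)
    (T : W → W) (hTmem : ∀ f : W, T f ∈ H)
    (hT : ∀ f : W, ∀ v ∈ H, a (T f) v = ⟪f, v⟫)
    (P : W → W) (hPmem : ∀ w ∈ H, P w ∈ S)
    (hPorth : ∀ w ∈ H, ∀ s ∈ S, a (w - P w) s = 0)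
    (η : ℝ)
    (hη : η = sSup {r : ℝ | ∃ f : W, ‖f‖ = 1 ∧
      r = sInf {s : ℝ | ∃ v ∈ S, s = Real.sqrt (a (T f - v) (T f - v))}})
    (lambar : ℝ) (hlambar : 0 < lambar)
    (ubar : W) (hubar : ubar ∈ H)
    (heig : ∀ v ∈ H, a ubar v = lambar * ⟪ubar, v⟫)
    (q : W) (hq : q ∈ H) (hTq : lambar • T q ∈ S) :
    Real.sqrt (a (ubar - P ubar) (ubar - P ubar)) ≤ lambar * η * ‖ubar - q‖ := by
  have hnonneg : ∀ v ∈ H, 0 ≤ a v v := fun v hv => by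
    rcases eq_or_ne v 0 with rfl | h
    · simp
    · exact (hpos v hv h).le
  have hbest : ∀ s ∈ S, a (ubar - P ubar) (ubar - P ubar) ≤ a (ubar - s) (ubar - s) :=
    fun s hs => bilin_le_of_orthogonal hsymm (fun v hv => hnonneg v (hSH hv))
      (hPmem ubar hubar) hs (hPorth ubar hubar)
  set g := ubar - q with hg
  have hsol : ∀ f : W, ‖g‖ • f = g → ubar - lambar • T q = (lambar * ‖g‖) • T f := fun f hf => by
    refine eq_of_bilin_eq_on hpos (H.sub_mem hubar (H.smul_mem _ (hTmem q)))
      (H.smul_mem _ (hTmem f)) fun v hv => ?_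
    have hfv : ‖g‖ * ⟪f, v⟫ = ⟪ubar, v⟫ - ⟪q, v⟫ := by
      rw [← real_inner_smul_left, hf, hg, inner_sub_left]
    simp only [map_sub, map_smul, LinearMap.sub_apply, LinearMap.smul_apply, smul_eq_mul,
      heig v hv, hT _ v hv]
    rw [mul_assoc, hfv, mul_sub]
  rcases eq_or_ne g 0 with h0 | h0
  · have hu := hsol 0 (by simp [h0])
    have h := hbest _ hTq
    rw [hu] at h
    simp only [h0, norm_zero, mul_zero, zero_smul, map_zero] at h ⊢
    exact (Real.sqrt_eq_zero_of_nonpos h).le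
  have hgpos : 0 < ‖g‖ := norm_pos_iff.2 h0
  have hc : 0 < lambar * ‖g‖ := mul_pos hlambar hgpos
  have hbdd : BddAbove {r : ℝ | ∃ f : W, ‖f‖ = 1 ∧
      r = sInf {s : ℝ | ∃ v ∈ S, s = Real.sqrt (a (T f - v) (T f - v))}} := by
    obtain ⟨K, -, hK⟩ := exists_norm_solution_le hpos hTmem hT
    refine ⟨Real.sqrt K, ?_⟩
    rintro r ⟨f, hf, rfl⟩
    have hle : sInf {s : ℝ | ∃ v ∈ S, s = Real.sqrt (a (T f - v) (T f - v))} ≤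
        Real.sqrt (a (T f) (T f)) := by
      refine csInf_le ⟨0, ?_⟩ ⟨0, S.zero_mem, by rw [sub_zero]⟩
      rintro s ⟨v, -, rfl⟩
      exact Real.sqrt_nonneg _
    refine hle.trans (Real.sqrt_le_sqrt ?_)
    rw [hT f _ (hTmem f)]
    have h1 := real_inner_le_norm f (T f)
    have h2 := hK f
    rw [hf] at h1 h2
    linarith
  have hη_le : Real.sqrt (a (ubar - P ubar) (ubar - P ubar)) / (lambar * ‖g‖) ≤ η := by
    set f := ‖g‖⁻¹ • g with hf
    have hfg : ‖g‖ • f = g := smul_inv_smul₀ hgpos.ne' g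
    refine le_trans ?_ (hη ▸ le_csSup hbdd ⟨f, norm_smul_inv_norm h0, rfl⟩)
    refine le_csInf ⟨_, 0, S.zero_mem, rfl⟩ ?_
    rintro s ⟨v, hv, rfl⟩
    rw [div_le_iff₀' hc]
    have h := hbest _ (S.add_mem hTq (S.smul_mem (lambar * ‖g‖) hv))
    rw [← sub_sub, hsol f hfg, ← smul_sub] at h
    simp only [map_smul, LinearMap.smul_apply, smul_eq_mul] at h
    refine (Real.sqrt_le_sqrt h).trans_eq ?_
    rw [← mul_assoc, Real.sqrt_mul (mul_self_nonneg _), Real.sqrt_mul_self hc.le]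
  rw [div_le_iff₀' hc] at hη_le
  linarith
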